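/- Let Z be a positive integer. Let E_1, ..., E_Z be Hermitian positive semidefinite complex Z×Z matrices with Σ_{z=1}^Z E_z = I, and let ρ_1, ..., ρ_Z be density matrices on ℂ^Z such that tr(ρ_z E_z) = 1 for every z ∈ {1,...,Z}. Then for every z: ρ_z = E_z, and there exist vectors v_1, ..., v_Z ∈ ℂ^Z forming an orthonormal basis of ℂ^Z such that E_z = v_z v_z* for all z; in particular each E_z is a rank-one orthogonal projection and E_z E_{z'} = 0 whenever z ≠ z'. -/

import Mathlib

open Matrix BigOperators
open scoped ComplexOrder

namespace Matrix

variable {n : Type*} [Fintype n]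

open scoped MatrixOrder in
theorem PosSemidef.mul_eq_zero_of_trace_mul_eq_zero {A B : Matrix n n ℂ}
    (hA : A.PosSemidef) (hB : B.PosSemidef) (h : (A * B).trace = 0) : A * B = 0 := by
  classical
  obtain ⟨X, rfl⟩ := CStarAlgebra.nonneg_iff_eq_star_mul_self.mp hA.nonneg
  obtain ⟨Y, rfl⟩ := CStarAlgebra.nonneg_iff_eq_star_mul_self.mp hB.nonneg
  simp only [star_eq_conjTranspose] at h ⊢
  have hXY : X * Yᴴ = 0 := by
    rw [← trace_mul_conjTranspose_self_eq_zero_iff, conjTranspose_mul, conjTranspose_conjTranspose,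
      ← h, Matrix.mul_assoc Xᴴ, trace_mul_comm Xᴴ]
    simp only [Matrix.mul_assoc]
  rw [Matrix.mul_assoc, ← Matrix.mul_assoc X, hXY, Matrix.zero_mul, Matrix.mul_zero]

/-- If an effect `B` has outcome probability one in the state `A`, then `B` fixes the range
of `A`. -/
theorem PosSemidef.mul_eq_right_of_trace_mul_eq_one [DecidableEq n] {A B : Matrix n n ℂ}
    (hA : A.PosSemidef) (hB : (1 - B).PosSemidef) (hA_tr : A.trace = 1)
    (h : (B * A).trace = 1) : B * A = A := by
  have key := hB.mul_eq_zero_of_trace_mul_eq_zero hA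
    (by rw [Matrix.sub_mul, Matrix.one_mul, trace_sub, hA_tr, h, sub_self])
  rw [Matrix.sub_mul, Matrix.one_mul, sub_eq_zero] at key
  exact key.symm

theorem exists_unit_mulVec_eq_self {A B : Matrix n n ℂ}
    (hA : A ≠ 0) (h : B * A = A) : ∃ v : n → ℂ, v ⬝ᵥ star v = 1 ∧ B *ᵥ v = v := by
  classical
  obtain ⟨j, hj⟩ : ∃ j, A.col j ≠ 0 := by
    by_contra! hcol
    exact hA (by ext i j; exact congrFun (hcol j) i)
  set w := A.col j
  have hBw : B *ᵥ w = w := by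
    rw [show w = A *ᵥ Pi.single j 1 from (mulVec_single_one A j).symm, mulVec_mulVec, h]
  have hw : WithLp.toLp 2 w ≠ 0 := by simpa using hj
  refine ⟨((‖WithLp.toLp 2 w‖ : ℂ)⁻¹) • w, ?_, by rw [mulVec_smul, hBw]⟩
  rw [← EuclideanSpace.inner_toLp_toLp, WithLp.toLp_smul, inner_self_eq_norm_sq_to_K,
    show ‖((‖WithLp.toLp 2 w‖ : ℂ)⁻¹) • WithLp.toLp 2 w‖ = 1 from norm_smul_inv_norm hw]
  simp

/-- A positive resolution of the identity: a vector fixed by one summand is annihilated by the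
others. -/
theorem PosSemidef.mulVec_eq_zero_of_sum_eq_one [DecidableEq n] {ι : Type*} [Fintype ι]
    {E : ι → Matrix n n ℂ} (hE : ∀ i, (E i).PosSemidef) (hsum : ∑ i, E i = 1)
    {i j : ι} (hij : j ≠ i) {v : n → ℂ} (hv : E i *ᵥ v = v) : E j *ᵥ v = 0 := by
  classical
  have hrest : ∑ k ∈ Finset.univ.erase i, star v ⬝ᵥ (E k *ᵥ v) = 0 := by
    have htotal : ∑ k, star v ⬝ᵥ (E k *ᵥ v) = star v ⬝ᵥ v := by
      rw [← dotProduct_sum, ← sum_mulVec, hsum, one_mulVec]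
    rw [← Finset.add_sum_erase _ _ (Finset.mem_univ i), hv] at htotal
    simpa using htotal
  rw [Finset.sum_eq_zero_iff_of_nonneg fun k _ => (hE k).dotProduct_mulVec_nonneg v] at hrest
  exact ((hE j).dotProduct_mulVec_zero_iff v).mp
    (hrest j (Finset.mem_erase.mpr ⟨hij, Finset.mem_univ j⟩))

theorem eq_vecMulVec_of_mulVec_orthonormalBasis {ι : Type*} [Fintype ι]
    (b : OrthonormalBasis ι ℂ (EuclideanSpace ℂ n)) {A : Matrix n n ℂ} {i : ι}
    (hself : A *ᵥ b i = b i) (hother : ∀ j, j ≠ i → A *ᵥ b j = 0) :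
    A = vecMulVec (b i) (star (b i)) := by
  classical
  refine toEuclideanLin.injective (b.toBasis.ext fun j => ?_)
  ext1
  have hinner := b.inner_eq_ite i j
  rw [EuclideanSpace.inner_eq_star_dotProduct, dotProduct_comm] at hinner
  simp only [OrthonormalBasis.coe_toBasis, ofLp_toLpLin, toLin'_apply, vecMulVec_mulVec, hinner]
  by_cases hji : j = i
  · subst hji
    simp [hself]
  · simp [hother j hji, Ne.symm hji]

/-- A rank-one matrix fixing the range of a Hermitian matrix `A` of trace one equals `A`. -/
theorem IsHermitian.eq_vecMulVec_of_mul_eq_right {A : Matrix n n ℂ} {v : n → ℂ}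
    (hA : A.IsHermitian) (hA_tr : A.trace = 1) (hv : v ⬝ᵥ star v = 1)
    (h : vecMulVec v (star v) * A = A) : A = vecMulVec v (star v) := by
  have h' : A * vecMulVec v (star v) = A := by
    simpa [conjTranspose_mul, conjTranspose_vecMulVec, hA.eq] using congrArg Matrix.conjTranspose h
  have hsmul : A = (star v ⬝ᵥ (A *ᵥ v)) • vecMulVec v (star v) := by
    conv_lhs => rw [← h, ← h', mul_vecMulVec, vecMulVec_mul_vecMulVec, vecMulVec_smul]
  have hcoeff : star v ⬝ᵥ (A *ᵥ v) = 1 := by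
    have := congrArg trace hsmul
    rwa [trace_smul, trace_vecMulVec, hv, hA_tr, smul_eq_mul, mul_one, eq_comm] at this
  rwa [hcoeff, one_smul] at hsmul

theorem rank_vecMulVec_eq_one {v w : n → ℂ} (hv : v ≠ 0) (hw : w ≠ 0) :
    (vecMulVec v w).rank = 1 := by
  refine le_antisymm (rank_vecMulVec_le v w) (Nat.one_le_iff_ne_zero.mpr ?_)
  rw [Matrix.rank, Ne, Submodule.finrank_eq_zero, LinearMap.range_eq_bot]
  intro h
  refine vecMulVec_ne_zero hv hw (mulVec_injective (funext fun x => ?_))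
  simpa only [mulVecLin_apply, LinearMap.zero_apply, zero_mulVec] using LinearMap.congr_fun h x

end Matrix

/-- If `(E_1,...,E_Z)` is a POVM on `ℂ^Z` and `ρ_1,...,ρ_Z` are density matrices
with `tr(ρ_z E_z) = 1` for all `z`, then `ρ_z = E_z` for all `z` and the `E_z`
are rank-one orthogonal projections `v_z v_z*` onto the elements of an
orthonormal basis `(v_z)` of `ℂ^Z`; in particular `E_z E_{z'} = 0` for `z ≠ z'`. -/
theorem povm_perfectly_distinguishing_is_orthonormal_basis
    {Z : ℕ} (hZ : 0 < Z)
    (E : Fin Z → Matrix (Fin Z) (Fin Z) ℂ)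
    (hE_psd : ∀ z, (E z).PosSemidef)
    (hE_sum : ∑ z, E z = (1 : Matrix (Fin Z) (Fin Z) ℂ))
    (ρ : Fin Z → Matrix (Fin Z) (Fin Z) ℂ)
    (hρ_psd : ∀ z, (ρ z).PosSemidef) (hρ_tr : ∀ z, (ρ z).trace = 1)
    (htr : ∀ z, (ρ z * E z).trace = 1) :
    (∀ z, ρ z = E z) ∧
    (∃ v : OrthonormalBasis (Fin Z) ℂ (EuclideanSpace ℂ (Fin Z)),
      ∀ z, E z = Matrix.vecMulVec (v z) (star (v z))) ∧
    (∀ z, E z * E z = E z ∧ (E z).rank = 1) ∧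
    (∀ z z', z ≠ z' → E z * E z' = 0) := by
  have hcompl (z : Fin Z) : (1 - E z).PosSemidef := by
    rw [← hE_sum, ← Finset.add_sum_erase _ _ (Finset.mem_univ z), add_sub_cancel_left]
    exact posSemidef_sum _ fun k _ => hE_psd k
  have hEρ (z : Fin Z) : E z * ρ z = ρ z :=
    (hρ_psd z).mul_eq_right_of_trace_mul_eq_one (hcompl z) (hρ_tr z)
      (by rw [trace_mul_comm, htr z])
  have hρ_ne (z : Fin Z) : ρ z ≠ 0 := fun h => by simpa [h] using hρ_tr z
  choose u hu_unit hu_fix using fun z => exists_unit_mulVec_eq_self (hρ_ne z) (hEρ z)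
  have hu_kill {z z' : Fin Z} (h : z' ≠ z) : E z' *ᵥ u z = 0 :=
    PosSemidef.mulVec_eq_zero_of_sum_eq_one hE_psd hE_sum h (hu_fix z)
  have hu_orth {z z' : Fin Z} (h : z ≠ z') : u z ⬝ᵥ star (u z') = 0 := by
    rw [dotProduct_comm, ← hu_fix z', star_mulVec, (hE_psd z').isHermitian.eq,
      ← dotProduct_mulVec, hu_kill h.symm, dotProduct_zero]
  have hon : Orthonormal ℂ fun z => WithLp.toLp 2 (u z) := by
    rw [orthonormal_iff_ite]
    intro z z'
    rw [EuclideanSpace.inner_toLp_toLp]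
    split_ifs with h
    · rw [h, hu_unit]
    · exact hu_orth (Ne.symm h)
  have : Nonempty (Fin Z) := ⟨⟨0, hZ⟩⟩
  let b : OrthonormalBasis (Fin Z) ℂ (EuclideanSpace ℂ (Fin Z)) :=
    (basisOfOrthonormalOfCardEqFinrank hon (by simp)).toOrthonormalBasis (by simpa using hon)
  have hb (z : Fin Z) : b z = WithLp.toLp 2 (u z) := by simp [b]
  have hE (z : Fin Z) : E z = vecMulVec (u z) (star (u z)) := by
    have := eq_vecMulVec_of_mulVec_orthonormalBasis b (A := E z) (i := z)
      (by rw [hb]; exact hu_fix z) (fun j hj => by rw [hb]; exact hu_kill hj.symm)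
    rwa [hb] at this
  have hu_ne (z : Fin Z) : u z ≠ 0 := fun h => by simpa [h] using hu_unit z
  refine ⟨fun z => ?_, ⟨b, fun z => by rw [hb]; exact hE z⟩, fun z => ⟨?_, ?_⟩, fun z z' h => ?_⟩
  · rw [hE z]
    exact (hρ_psd z).isHermitian.eq_vecMulVec_of_mul_eq_right (hρ_tr z) (hu_unit z)
      (by rw [← hE z, hEρ z])
  · nth_rw 2 3 [hE z]
    rw [mul_vecMulVec, hu_fix]
  · rw [hE z]
    exact rank_vecMulVec_eq_one (hu_ne z) (star_ne_zero.mpr (hu_ne z))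
  · rw [hE z', mul_vecMulVec, hu_kill h, zero_vecMulVec]
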